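/- Let Δ ≥ 2 be a natural number and let G be a connected Δ-regular simple graph (every vertex has exactly Δ neighbours). Then G admits a distinguishing edge colouring with 3 colours, i.e. D'(G) ≤ 3. -/

import Mathlib

open SimpleGraph

/-- `G` admits a distinguishing edge colouring with `k` colours. -/
def HasDistinguishingEdgeColoring {V : Type*} (G : SimpleGraph V) (k : ℕ) : Prop :=
  ∃ c : G.edgeSet → Fin k,
    ∀ φ : G ≃g G, (∀ e : G.edgeSet, c (φ.mapEdgeSet e) = c e) → ∀ v : V, φ v = v

namespace DistinguishingRegular
section
open scoped Classical
variable {V : Type*}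

/-- `comp` and `pos` describe a partition of `A` into paths of `G`: the vertices with the same value
of `comp` form a path, on which `pos` counts from the first vertex, its head. -/
structure IsPathSystem (G : SimpleGraph V) (A : Finset V) (comp : V → V) (pos : V → ℕ) : Prop where
  inj : ∀ u ∈ A, ∀ v ∈ A, comp u = comp v → pos u = pos v → u = v
  pred : ∀ u ∈ A, pos u ≠ 0 → ∃ v ∈ A, comp v = comp u ∧ pos v + 1 = pos u ∧ G.Adj v u

/-- Consecutive vertices on a path of a path system. -/
def Consecutive (comp : V → V) (pos : V → ℕ) (u v : V) : Prop :=
  comp u = comp v ∧ (pos u + 1 = pos v ∨ pos v + 1 = pos u)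

theorem Consecutive.symm {comp : V → V} {pos : V → ℕ} {u v : V} (h : Consecutive comp pos u v) :
    Consecutive comp pos v u := ⟨h.1.symm, h.2.symm⟩

theorem isPathSystem_trivial (G : SimpleGraph V) (A : Finset V) :
    IsPathSystem G A id (fun _ => 0) where
  inj := fun _ _ _ _ h _ => h
  pred := fun _ _ h => absurd rfl h

variable {G : SimpleGraph V} {A : Finset V} {comp : V → V} {pos : V → ℕ}

theorem IsPathSystem.adj (h : IsPathSystem G A comp pos) {u v : V} (hu : u ∈ A) (hv : v ∈ A)
    (huv : Consecutive comp pos u v) : G.Adj u v := by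
  obtain ⟨hc, hp | hp⟩ := huv
  · obtain ⟨w, hw, hwc, hwp, hadj⟩ := h.pred v hv (by omega)
    rwa [h.inj u hu w hw (hc.trans hwc.symm) (by omega)]
  · obtain ⟨w, hw, hwc, hwp, hadj⟩ := h.pred u hu (by omega)
    rw [h.inj v hv w hw (hc.symm.trans hwc.symm) (by omega)]
    exact hadj.symm

/-- Two paths of a path system can be joined when the last vertex of one is adjacent to the head of
the other. -/
theorem IsPathSystem.exists_join (h : IsPathSystem G A comp pos) {p q : V} (hp : p ∈ A)
    (hq : q ∈ A) (hq0 : pos q = 0) (hne : comp p ≠ comp q)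
    (hmax : ∀ w ∈ A, comp w = comp p → pos w ≤ pos p) (hadj : G.Adj p q) :
    ∃ comp' pos', IsPathSystem G A comp' pos' ∧
      (A.filter (fun u => pos' u = 0)).card < (A.filter (fun u => pos u = 0)).card := by
  refine ⟨fun u => if comp u = comp q then comp p else comp u,
    fun u => if comp u = comp q then pos u + pos p + 1 else pos u, ⟨?_, ?_⟩, ?_⟩
  · intro u hu v hv hc hpos
    split_ifs at hc hpos with h1 h2 h2
    · exact h.inj u hu v hv (h1.trans h2.symm) (by omega)
    · have := hmax v hv hc.symm
      omega
    · have := hmax u hu hc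
      omega
    · exact h.inj u hu v hv hc hpos
  · intro u hu hpos
    by_cases h1 : comp u = comp q
    · by_cases h0 : pos u = 0
      · obtain rfl := h.inj u hu q hq h1 (h0.trans hq0.symm)
        exact ⟨p, hp, by simp [hne], by simp [hne, h0], hadj⟩
      · obtain ⟨v, hv, hvc, hvp, hvadj⟩ := h.pred u hu h0
        refine ⟨v, hv, by simp [hvc, h1], ?_, hvadj⟩
        simp only [hvc, h1, if_true]
        omega
    · rw [if_neg h1] at hpos
      obtain ⟨v, hv, hvc, hvp, hvadj⟩ := h.pred u hu hpos
      exact ⟨v, hv, by simp [hvc, h1], by simp [hvc, h1, hvp], hvadj⟩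
  · apply Finset.card_lt_card
    refine ⟨fun u hu => ?_, fun hsub => ?_⟩
    · simp only [Finset.mem_filter] at hu ⊢
      refine ⟨hu.1, ?_⟩
      by_contra h0
      have := hu.2
      split_ifs at this
      exact h0 this
    · have := hsub (Finset.mem_filter.2 ⟨hq, hq0⟩)
      simp at this

/-- A path system with as few paths as possible has heads of small degree. -/
theorem exists_isPathSystem (G : SimpleGraph V) (A : Finset V) :
    ∃ comp pos, IsPathSystem G A comp pos ∧ ∀ q ∈ A, pos q = 0 →
      (A.filter (G.Adj q)).card + (A.filter (fun u => pos u = 0)).card ≤ A.card := by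
  have key : ∀ m : ℕ, ∀ comp pos, IsPathSystem G A comp pos →
      (A.filter (fun u => pos u = 0)).card = m → ∃ comp pos, IsPathSystem G A comp pos ∧
      ∀ q ∈ A, pos q = 0 →
        (A.filter (G.Adj q)).card + (A.filter (fun u => pos u = 0)).card ≤ A.card := by
    intro m
    induction m using Nat.strong_induction_on with
    | _ m ih =>
    intro comp pos h hm
    by_contra hcon
    have hbad := hcon
    push Not at hbad
    obtain ⟨q, hq, hq0, hlt⟩ := hbad comp pos h
    have tail : ∀ x ∈ A, ∃ p ∈ A, comp p = comp x ∧
        ∀ w ∈ A, comp w = comp p → pos w ≤ pos p := by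
      intro x hx
      obtain ⟨p, hp, hmax⟩ := Finset.exists_max_image (A.filter (fun w => comp w = comp x)) pos
        ⟨x, by simp [hx]⟩
      simp only [Finset.mem_filter] at hp hmax
      exact ⟨p, hp.1, hp.2, fun w hw hwp => hmax w ⟨hw, hwp.trans hp.2⟩⟩
    choose! T hTA hTc hTm using tail
    have hnadj : ∀ x ∈ A, comp x ≠ comp q → ¬ G.Adj (T x) q := by
      intro x hx hxq hadj
      obtain ⟨comp', pos', h', hlt'⟩ := h.exists_join (hTA x hx) hq hq0
        (by rw [hTc x hx]; exact hxq) (hTm x hx) hadj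
      exact hcon (ih _ (hm ▸ hlt') comp' pos' h' rfl)
    have hne : ∀ x ∈ (A.filter (fun u => pos u = 0)).erase q, x ∈ A ∧ pos x = 0 ∧
        comp x ≠ comp q := by
      intro x hx
      simp only [Finset.mem_erase, Finset.mem_filter] at hx
      exact ⟨hx.2.1, hx.2.2, fun hc => hx.1 (h.inj x hx.2.1 q hq hc (hx.2.2.trans hq0.symm))⟩
    have hinj : Set.InjOn T ((A.filter (fun u => pos u = 0)).erase q : Finset V) := by
      intro x hx y hy hxy
      have hx' := hne x hx
      have hy' := hne y hy
      refine h.inj x hx'.1 y hy'.1 ?_ (hx'.2.1.trans hy'.2.1.symm)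
      rw [← hTc x hx'.1, ← hTc y hy'.1, hxy]
    have hcard := Finset.card_image_of_injOn hinj
    have hqmem : q ∈ A.filter (fun u => pos u = 0) := by simp [hq, hq0]
    rw [Finset.card_erase_of_mem hqmem] at hcard
    have hpos := Finset.card_pos.2 ⟨q, hqmem⟩
    have hdisj : Disjoint (A.filter (G.Adj q))
        (((A.filter (fun u => pos u = 0)).erase q).image T) := by
      rw [Finset.disjoint_right]
      intro y hy
      obtain ⟨x, hx, rfl⟩ := Finset.mem_image.1 hy
      have hx' := hne x hx
      simp only [Finset.mem_filter, not_and]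
      exact fun _ hadj => hnadj x hx'.1 hx'.2.2 hadj.symm
    have hsub : A.filter (G.Adj q) ∪ ((A.filter (fun u => pos u = 0)).erase q).image T ⊆
        A.erase q := by
      intro y hy
      rw [Finset.mem_union] at hy
      rcases hy with hy | hy
      · simp only [Finset.mem_filter] at hy
        exact Finset.mem_erase.2 ⟨hy.2.ne', hy.1⟩
      · obtain ⟨x, hx, rfl⟩ := Finset.mem_image.1 hy
        have hx' := hne x hx
        refine Finset.mem_erase.2 ⟨fun hxq => hx'.2.2 ?_, hTA x hx'.1⟩
        rw [← hTc x hx'.1, hxq]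
    have := Finset.card_le_card hsub
    rw [Finset.card_union_of_disjoint hdisj, hcard, Finset.card_erase_of_mem hq] at this
    have := Finset.card_pos.2 ⟨q, hq⟩
    omega
  exact key _ _ _ (isPathSystem_trivial G A) rfl

/-- A bijection that preserves consecutiveness in a path system and fixes the heads is trivial. -/
theorem IsPathSystem.eq_of_heads (h : IsPathSystem G A comp pos) {φ : V → V}
    (hφ : Function.Injective φ) (hA : ∀ u ∈ A, φ u ∈ A)
    (hcons : ∀ u ∈ A, ∀ v ∈ A, Consecutive comp pos u v → Consecutive comp pos (φ u) (φ v))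
    (hhead : ∀ u ∈ A, pos u = 0 → φ u = u) : ∀ u ∈ A, φ u = u := by
  have key : ∀ m, ∀ u ∈ A, pos u = m → φ u = u := by
    intro m
    induction m using Nat.strong_induction_on with
    | _ m ih =>
    intro u hu hm
    by_cases h0 : pos u = 0
    · exact hhead u hu h0
    obtain ⟨p, hp, hpc, hpp, -⟩ := h.pred u hu h0
    have hfix := ih (pos p) (by omega) p hp rfl
    have hc := hcons p hp u hu ⟨hpc, Or.inl hpp⟩
    rw [hfix] at hc
    obtain ⟨hc1, hc2 | hc2⟩ := hc
    · exact h.inj _ (hA u hu) u hu (hc1.symm.trans hpc) (by omega)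
    · exact hφ (ih (pos (φ u)) (by omega) (φ u) (hA u hu) rfl)
  exact fun u hu => key _ u hu rfl

theorem IsPathSystem.exists_head (h : IsPathSystem G A comp pos) (hA : A.Nonempty) :
    ∃ u ∈ A, pos u = 0 := by
  obtain ⟨u, hu, hmin⟩ := Finset.exists_min_image A pos hA
  refine ⟨u, hu, ?_⟩
  by_contra h0
  obtain ⟨v, hv, -, hvp, -⟩ := h.pred u hu h0
  have := hmin v hv
  omega

/-- The heads of a path system can be numbered so that heads of paths with at least two vertices
receive positive numbers. -/
theorem IsPathSystem.exists_index (h : IsPathSystem G A comp pos) :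
    ∃ (idx : V → ℕ) (K : ℕ),
      (∀ u ∈ A, pos u = 0 → ∀ v ∈ A, pos v = 0 → idx u = idx v → u = v) ∧
      (∀ u ∈ A, pos u ≠ 0 → idx u = 0) ∧
      (∀ u ∈ A, ∀ v ∈ A, pos u = 0 → Consecutive comp pos u v → idx u ≠ 0) ∧
      (∀ u ∈ A, idx u < K) ∧
      (K = (A.filter (fun u => pos u = 0)).card ∨
        K = (A.filter (fun u => pos u = 0)).card + 1 ∧
          2 * (A.filter (fun u => pos u = 0)).card ≤ A.card ∧
          ∀ u ∈ A, pos u = 0 → ∃ v ∈ A, G.Adj u v) := by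
  set H := A.filter (fun u => pos u = 0) with hH
  have hmem : ∀ u, u ∈ H ↔ u ∈ A ∧ pos u = 0 := fun u => by simp [hH]
  obtain ⟨f⟩ : Nonempty (H ≃ Fin H.card) := ⟨H.equivFin⟩
  by_cases htriv : ∃ u ∈ A, pos u = 0 ∧ ∀ v ∈ A, ¬ Consecutive comp pos u v
  · obtain ⟨u₀, hu₀, hp₀, hno⟩ := htriv
    have hu₀H := (hmem u₀).2 ⟨hu₀, hp₀⟩
    have hkpos : 0 < H.card := Finset.card_pos.2 ⟨u₀, hu₀H⟩
    let g : H ≃ Fin H.card := f.trans (Equiv.swap (f ⟨u₀, hu₀H⟩) ⟨0, hkpos⟩)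
    have hg0 : g ⟨u₀, hu₀H⟩ = ⟨0, hkpos⟩ := by simp [g]
    refine ⟨fun u => if hu : u ∈ H then g ⟨u, hu⟩ else 0, H.card, ?_, ?_, ?_, ?_, Or.inl rfl⟩
    · intro u hu hu0 v hv hv0 huv
      have hu' := (hmem u).2 ⟨hu, hu0⟩
      have hv' := (hmem v).2 ⟨hv, hv0⟩
      simp only [hu', hv', dif_pos] at huv
      simpa using g.injective (Fin.ext huv)
    · intro u hu hu0
      have : u ∉ H := fun hmem' => hu0 ((hmem u).1 hmem').2
      simp [this]
    · intro u hu v hv hu0 huv hz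
      have hu' := (hmem u).2 ⟨hu, hu0⟩
      simp only [hu', dif_pos] at hz
      have : g ⟨u, hu'⟩ = g ⟨u₀, hu₀H⟩ := by rw [hg0]; exact Fin.ext hz
      have : u = u₀ := by simpa using g.injective this
      exact hno v hv (this ▸ huv)
    · intro u hu
      dsimp only
      split_ifs with hu'
      · exact (g ⟨u, hu'⟩).2
      · exact hkpos
  · push Not at htriv
    refine ⟨fun u => if hu : u ∈ H then f ⟨u, hu⟩ + 1 else 0, H.card + 1, ?_, ?_, ?_, ?_,
      Or.inr ⟨rfl, ?_, ?_⟩⟩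
    · intro u hu hu0 v hv hv0 huv
      have hu' := (hmem u).2 ⟨hu, hu0⟩
      have hv' := (hmem v).2 ⟨hv, hv0⟩
      simp only [hu', hv', dif_pos] at huv
      simpa using f.injective (Fin.ext (Nat.succ_injective huv))
    · intro u hu hu0
      have : u ∉ H := fun hmem' => hu0 ((hmem u).1 hmem').2
      simp [this]
    · intro u hu v hv hu0 huv
      simp [(hmem u).2 ⟨hu, hu0⟩]
    · intro u hu
      dsimp only
      split_ifs with hu'
      · have := (f ⟨u, hu'⟩).2
        omega
      · omega
    · choose! s hsA hs using htriv
      have hsH : ∀ u ∈ H, s u ∈ A ∧ comp (s u) = comp u ∧ pos (s u) = 1 := by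
        intro u hu
        obtain ⟨hu, hu0⟩ := (hmem u).1 hu
        obtain ⟨hc, hp⟩ := hs u hu hu0
        exact ⟨hsA u hu hu0, hc.symm, by omega⟩
      have hinj : Set.InjOn s (H : Set V) := by
        intro u hu v hv huv
        have hu' := hsH u hu
        have hv' := hsH v hv
        obtain ⟨huA, hu0⟩ := (hmem u).1 hu
        obtain ⟨hvA, hv0⟩ := (hmem v).1 hv
        exact h.inj u huA v hvA (by rw [← hu'.2.1, ← hv'.2.1, huv]) (by omega)
      have hdisj : Disjoint H (H.image s) := by
        rw [Finset.disjoint_right]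
        intro y hy hyH
        obtain ⟨u, hu, rfl⟩ := Finset.mem_image.1 hy
        have := ((hmem _).1 hyH).2
        have := (hsH u hu).2.2
        omega
      have hsub : H ∪ H.image s ⊆ A := by
        intro y hy
        rcases Finset.mem_union.1 hy with hy | hy
        · exact ((hmem y).1 hy).1
        · obtain ⟨u, hu, rfl⟩ := Finset.mem_image.1 hy
          exact (hsH u hu).1
      have := Finset.card_le_card hsub
      rw [Finset.card_union_of_disjoint hdisj, Finset.card_image_of_injOn hinj] at this
      omega
    · intro u hu hu0
      obtain ⟨v, hv, huv⟩ := htriv u hu hu0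
      exact ⟨v, hv, h.adj hu hv huv⟩

/-- Every finite set can be enumerated with a prescribed last element. -/
theorem exists_enumeration (N : Finset V) (hN : N.Nonempty) (e : V) :
    ∃ f : ℕ → V, (∀ i < N.card, f i ∈ N) ∧ (∀ i < N.card, ∀ j < N.card, f i = f j → i = j) ∧
      ∀ i < N.card, f i = e → i + 1 = N.card := by
  have hpos := Finset.card_pos.2 hN
  obtain ⟨d, hd, hlast⟩ : ∃ d ∈ N, e ∈ N → d = e := by
    by_cases he : e ∈ N
    · exact ⟨e, he, fun _ => rfl⟩
    · exact ⟨hN.choose, hN.choose_spec, fun h => absurd h he⟩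
  let l : Fin N.card := ⟨N.card - 1, by omega⟩
  let g : N ≃ Fin N.card := N.equivFin.trans (Equiv.swap (N.equivFin ⟨d, hd⟩) l)
  have hg : g ⟨d, hd⟩ = l := by simp [g]
  refine ⟨fun i => if h : i < N.card then (g.symm ⟨i, h⟩ : V) else d, ?_, ?_, ?_⟩
  · intro i hi
    simp [hi]
  · intro i hi j hj hij
    simp only [hi, hj, dif_pos] at hij
    simpa using g.symm.injective (Subtype.ext hij)
  · intro i hi hie
    simp only [hi, dif_pos] at hie
    have heN : e ∈ N := hie ▸ (g.symm ⟨i, hi⟩).2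
    have : g.symm ⟨i, hi⟩ = ⟨d, hd⟩ := Subtype.ext (hie.trans (hlast heN).symm)
    rw [Equiv.symm_apply_eq, hg] at this
    have := congrArg Fin.val this
    simp only [l] at this
    omega

/-- Tokens `(σ i, θ i)` that tell apart `K` vertices with common neighbourhood `N`: the edge to
`σ i` is marked, and `θ i` further edges are reserved. No vertex receives more than `a / 2` marks,
and `e` receives fewer. -/
theorem exists_tokens (N : Finset V) (hN : N.Nonempty) (e : V) {k K a : ℕ} (hk : 1 ≤ k)
    (hKk : K ≤ k + 1) (hKa : K ≤ a) (hka : k ≤ a) :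
    ∃ (σ : ℕ → Option V) (θ : ℕ → ℕ), σ 0 = none ∧ θ 0 = 0 ∧
      (∀ i < K, ∀ j < K, σ i = σ j → θ i = θ j → i = j) ∧
      (∀ i < K, ∀ x, σ i = some x → x ∈ N) ∧
      (∀ i < K, 2 * θ i ≤ (k + 1 - N.card) + 1) ∧
      (N.card = 1 → ∀ i < K, σ i ≠ none → θ i ≠ 0) ∧
      (∀ x, 2 * ((Finset.range K).filter (fun i => σ i = some x)).card ≤ a) ∧
      (2 * ((Finset.range K).filter (fun i => σ i = some e)).card + 1 ≤ a) := by
  obtain ⟨f, hfN, hfinj, hfe⟩ := exists_enumeration N hN e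
  have hn := Finset.card_pos.2 hN
  generalize N.card = n at *
  obtain ⟨q, hq⟩ : ∃ q, q = k + 1 - n := ⟨_, rfl⟩
  obtain ⟨E, hE⟩ : ∃ E, E = max 1 ((q + 1) / 2) := ⟨_, rfl⟩
  obtain ⟨D, hD⟩ : ∃ D, D = (q + 1) / 2 + 1 := ⟨_, rfl⟩
  have hE1 : 1 ≤ E := by omega
  have hKD : K ≤ D + n * E := by
    obtain ⟨n', rfl⟩ : ∃ n', n = n' + 1 := ⟨n - 1, by omega⟩
    obtain ⟨E', rfl⟩ : ∃ E', E = E' + 1 := ⟨E - 1, by omega⟩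
    have : (n' + 1) * (E' + 1) = n' * E' + n' + E' + 1 := by ring
    omega
  have hblock : ∀ i < K, D ≤ i → (i - D) / E < n := fun i hi hDi =>
    (Nat.div_lt_iff_lt_mul hE1).2 (by omega)
  have hcount : ∀ x, ((Finset.range K).filter (fun i =>
      (if i < D then none else some (f ((i - D) / E))) = some x)).card ≤
      ((Finset.range K).filter (fun i => D ≤ i ∧ f ((i - D) / E) = x)).card := by
    intro x
    apply Finset.card_le_card
    intro i
    simp only [Finset.mem_filter]
    intro ⟨hi, hx⟩
    split_ifs at hx with h
    exact ⟨hi, by omega, by simpa using hx⟩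
  have hsub : ∀ b < n, ((Finset.range K).filter (fun i => D ≤ i ∧ f ((i - D) / E) = f b)) ⊆
      Finset.Ico (D + b * E) (min K (D + b * E + E)) := by
    intro b hb i hi
    simp only [Finset.mem_filter, Finset.mem_range] at hi
    obtain ⟨hi, hDi, hfi⟩ := hi
    have hib := hfinj _ (hblock i hi hDi) b hb hfi
    have h1 := Nat.div_add_mod (i - D) E
    have h2 := Nat.mod_lt (i - D) hE1
    rw [hib, mul_comm] at h1
    simp only [Finset.mem_Ico, lt_min_iff]
    omega
  have hsize : ∀ b < n, ((Finset.range K).filter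
      (fun i => (if i < D then none else some (f ((i - D) / E))) = some (f b))).card ≤
      min K (D + b * E + E) - (D + b * E) := fun b hb =>
    (hcount _).trans ((Finset.card_le_card (hsub b hb)).trans (by simp))
  have hzero : ∀ x, (∀ b < n, f b ≠ x) → ((Finset.range K).filter
      (fun i => (if i < D then none else some (f ((i - D) / E))) = some x)).card = 0 := by
    intro x hx
    refine Nat.le_zero.1 ((hcount x).trans (Nat.le_zero.2 ?_))
    rw [Finset.card_eq_zero, Finset.filter_eq_empty_iff]
    intro i hi ⟨hDi, hfi⟩
    exact hx _ (hblock i (by simpa using hi) hDi) hfi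
  have hgen : ∀ b < n, 2 * (min K (D + b * E + E) - (D + b * E)) ≤ a := by
    intro b hb
    generalize b * E = B
    omega
  have hlst : ∀ b, b + 1 = n → 2 * (min K (D + b * E + E) - (D + b * E)) + 1 ≤ a := by
    rintro b rfl
    obtain ⟨E', rfl⟩ : ∃ E', E = E' + 1 := ⟨E - 1, by omega⟩
    rcases b with _ | m
    · omega
    · have : (m + 1) * (E' + 1) = m * E' + m + E' + 1 := by ring
      rw [this]
      generalize m * E' = B
      omega
  refine ⟨fun i => if i < D then none else some (f ((i - D) / E)),
    fun i => if i < D then i else if q = 0 then 0 else (i - D) % E + 1,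
    ?_, ?_, ?_, ?_, ?_, ?_, ?_, ?_⟩
  · simp only [ite_eq_left_iff]
    omega
  · simp only [ite_eq_left_iff]
    omega
  · intro i hi j hj hσ hθ
    simp only at hσ hθ
    split_ifs at hσ hθ with h1 h2 h2
    · exact hθ
    · have hb := hfinj _ (hblock i hi (by omega)) _ (hblock j hj (by omega)) (by simpa using hσ)
      obtain rfl : E = 1 := by omega
      simp only [Nat.div_one] at hb
      omega
    · have hb := hfinj _ (hblock i hi (by omega)) _ (hblock j hj (by omega)) (by simpa using hσ)
      have hi' := Nat.div_add_mod (i - D) E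
      have hj' := Nat.div_add_mod (j - D) E
      rw [hb] at hi'
      omega
  · intro i hi x hx
    simp only at hx
    split_ifs at hx with h1
    obtain rfl : f ((i - D) / E) = x := by simpa using hx
    exact hfN _ (hblock i hi (by omega))
  · intro i hi
    have := Nat.mod_lt (i - D) hE1
    simp only
    split_ifs <;> omega
  · intro hn1 i hi hσ
    simp only [ne_eq, ite_eq_left_iff, reduceCtorEq, imp_false, not_not] at hσ
    simp only [hσ, if_false]
    split_ifs <;> omega
  · intro x
    by_cases hx : ∃ b < n, f b = x
    · obtain ⟨b, hb, rfl⟩ := hx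
      exact (Nat.mul_le_mul_left 2 (hsize b hb)).trans (hgen b hb)
    · push Not at hx
      rw [hzero x hx]
      omega
  · by_cases hx : ∃ b < n, f b = e
    · obtain ⟨b, hb, hbe⟩ := hx
      have h1 := hsize b hb
      rw [hbe] at h1
      exact (Nat.add_le_add_right (Nat.mul_le_mul_left 2 h1) 1).trans (hlst b (hfe b hb hbe))
    · push Not at hx
      rw [hzero e hx]
      omega

/-- The number of edges of colour `1` from `x` to vertices of `F`. -/
noncomputable def insideOnes (G : SimpleGraph V) (C : V → V → Fin 3) (F : Finset V) (x : V) : ℕ :=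
  (F.filter (fun y => G.Adj x y ∧ C x y = 1)).card

/-- `φ` preserves the colours `C` of the edges of `G`. -/
def Preserves (C : V → V → Fin 3) (φ : G ≃g G) : Prop :=
  ∀ x y, G.Adj x y → C (φ x) (φ y) = C x y

/-- The state `(F', c', t')` extends `(F, c, t)` by fulfilling some of its promises. -/
structure Extends (G : SimpleGraph V) (F : Finset V) (c : V → V → Fin 3) (t : V → ℕ)
    (F' : Finset V) (c' : V → V → Fin 3) (t' : V → ℕ) : Prop where
  subset : F ⊆ F'
  agree : ∀ x ∈ F, ∀ y ∈ F, c' x y = c x y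
  twos : ∀ x ∈ F, t x =
    t' x + ((F' \ F).filter (fun y => G.Adj x y ∧ c' x y = 2)).card

theorem Extends.refl (F : Finset V) (c : V → V → Fin 3) (t : V → ℕ) : Extends G F c t F c t where
  subset := subset_rfl
  agree := fun _ _ _ _ => rfl
  twos := by simp

theorem Extends.trans {F F' F'' : Finset V} {c c' c'' : V → V → Fin 3} {t t' t'' : V → ℕ}
    (h : Extends G F c t F' c' t') (h' : Extends G F' c' t' F'' c'' t'') :
    Extends G F c t F'' c'' t'' where
  subset := h.subset.trans h'.subset
  agree := fun x hx y hy => by rw [h'.agree x (h.subset hx) y (h.subset hy), h.agree x hx y hy]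
  twos := by
    intro x hx
    have hsplit : (F'' \ F).filter (fun y => G.Adj x y ∧ c'' x y = 2) =
        (F'' \ F').filter (fun y => G.Adj x y ∧ c'' x y = 2) ∪
          (F' \ F).filter (fun y => G.Adj x y ∧ c' x y = 2) := by
      ext y
      simp only [Finset.mem_filter, Finset.mem_sdiff, Finset.mem_union]
      by_cases hy : y ∈ F'
      · rw [h'.agree x (h.subset hx) y hy]
        simp [hy, h'.subset hy]
      · have : y ∉ F := fun hyF => hy (h.subset hyF)
        simp [hy, this]
    rw [hsplit, Finset.card_union_of_disjoint, h.twos x hx, h'.twos x (h.subset hx)]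
    · ring
    · rw [Finset.disjoint_left]
      intro y hy hy'
      simp only [Finset.mem_filter, Finset.mem_sdiff] at hy hy'
      exact hy.1.2 hy'.1.1

/-- Extension of the colouring `c` to the edges meeting `A`: paths of a path system receive colour
`2`, the edge from `u ∈ A` to `S u` receives colour `1`, and the edges from `x` to `J x` receive
colour `2`. -/
noncomputable def extendColour (A : Finset V) (comp : V → V) (pos : V → ℕ) (S : V → Option V)
    (J : V → Finset V) (c : V → V → Fin 3) (x y : V) : Fin 3 :=
  if x ∈ A then
    if y ∈ A then if Consecutive comp pos x y then 2 else 0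
    else if S x = some y then 1 else if x ∈ J y then 2 else 0
  else if y ∈ A then if S y = some x then 1 else if y ∈ J x then 2 else 0
  else c x y

section extendColour

variable {S : V → Option V} {J : V → Finset V} {c : V → V → Fin 3} {x y : V}

theorem extendColour_symm (hc : ∀ x y, c x y = c y x) (x y : V) :
    extendColour A comp pos S J c x y = extendColour A comp pos S J c y x := by
  have : Consecutive comp pos x y ↔ Consecutive comp pos y x := ⟨.symm, .symm⟩
  unfold extendColour
  by_cases hx : x ∈ A <;> by_cases hy : y ∈ A <;> simp [hx, hy, this, hc x y]

theorem extendColour_inner_eq_two (hx : x ∈ A) (hy : y ∈ A) :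
    extendColour A comp pos S J c x y = 2 ↔ Consecutive comp pos x y := by
  simp [extendColour, hx, hy]

theorem extendColour_inner_ne_one (hx : x ∈ A) (hy : y ∈ A) :
    extendColour A comp pos S J c x y ≠ 1 := by
  simp only [extendColour, hx, hy, if_true]
  split_ifs <;> decide

theorem extendColour_cross_eq_one (hx : x ∉ A) (hy : y ∈ A) :
    extendColour A comp pos S J c x y = 1 ↔ S y = some x := by
  simp only [extendColour, hx, hy, if_true, if_false]
  split_ifs with h1 h2 <;> simp [h1]

theorem extendColour_cross_eq_two (hx : x ∉ A) (hy : y ∈ A) :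
    extendColour A comp pos S J c x y = 2 ↔ S y ≠ some x ∧ y ∈ J x := by
  simp only [extendColour, hx, hy, if_true, if_false]
  split_ifs with h1 h2 <;> simp_all

theorem extendColour_old (hx : x ∉ A) (hy : y ∉ A) :
    extendColour A comp pos S J c x y = c x y := by
  simp [extendColour, hx, hy]

end extendColour

/-- `A` is the set of all vertices outside `F` whose neighbourhood in `F` is `N`. -/
def IsClass (G : SimpleGraph V) (F N A : Finset V) : Prop :=
  ∀ u, u ∈ A ↔ u ∉ F ∧ F.filter (G.Adj u) = N

theorem IsClass.disjoint {F N : Finset V} (hA : IsClass G F N A) : Disjoint F A :=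
  Finset.disjoint_right.2 fun u hu => ((hA u).1 hu).1

theorem IsClass.adj_iff {F N : Finset V} (hA : IsClass G F N A) {u x : V} (hu : u ∈ A)
    (hx : x ∈ F) : G.Adj u x ↔ x ∈ N := by
  rw [← ((hA u).1 hu).2]
  simp [hx]

theorem IsClass.subset {F N : Finset V} (hA : IsClass G F N A) {u : V} (hu : u ∈ A) : N ⊆ F := by
  rw [← ((hA u).1 hu).2]
  exact Finset.filter_subset _ _

section

variable {F N : Finset V} {S : V → Option V} {J : V → Finset V} {c : V → V → Fin 3}

theorem IsClass.insideOnes_old (hA : IsClass G F N A) {x : V} (hxF : x ∈ F)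
    (hS : ∀ u ∈ A, ∀ y, S u = some y → y ∈ N) :
    insideOnes G (extendColour A comp pos S J c) (F ∪ A) x =
      insideOnes G c F x + (A.filter (fun u => S u = some x)).card := by
  have hdisj := Finset.disjoint_left.1 hA.disjoint
  rw [insideOnes, Finset.filter_union, Finset.card_union_of_disjoint
    (Finset.disjoint_filter_filter hA.disjoint), insideOnes]
  congr 2
  · refine Finset.filter_congr fun y hy => ?_
    rw [extendColour_old (hdisj hxF) (hdisj hy)]
  · refine Finset.filter_congr fun u hu => ?_
    rw [extendColour_cross_eq_one (hdisj hxF) hu]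
    exact ⟨And.right, fun h => ⟨((hA.adj_iff hu hxF).2 (hS u hu x h)).symm, h⟩⟩

theorem insideOnes_extendColour_le (hc : ∀ x y, c x y = c y x) {u : V} (hu : u ∈ A) :
    insideOnes G (extendColour A comp pos S J c) (F ∪ A) u ≤
      (S u).toFinset.card := by
  refine Finset.card_le_card fun y hy => ?_
  simp only [Finset.mem_filter, Finset.mem_union] at hy
  obtain ⟨hy, -, h1⟩ := hy
  by_cases hyA : y ∈ A
  · exact absurd h1 (extendColour_inner_ne_one hu hyA)
  · rw [extendColour_symm hc, extendColour_cross_eq_one hyA hu] at h1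
    simp [h1]

end

variable [G.LocallyFinite]

/-- The number of neighbours of `x` outside `F`. -/
noncomputable def outside (G : SimpleGraph V) [G.LocallyFinite] (F : Finset V) (x : V) : ℕ :=
  (G.neighborFinset x \ F).card

/-- The number of edges of colour `2` from `x` to vertices outside `F`. -/
noncomputable def outsideTwos (G : SimpleGraph V) [G.LocallyFinite] (C : V → V → Fin 3)
    (F : Finset V) (x : V) : ℕ :=
  ((G.neighborFinset x \ F).filter (fun y => C x y = 2)).card

/-- An automorphism fixing a finite set `F` pointwise and preserving colours also fixes the vertices
outside `F` with neighbourhood `N` in `F`, provided that colours and numbers of outer edges of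
colour `2` determine the indices of the heads of a path system. -/
theorem IsPathSystem.fixes (h : IsPathSystem G A comp pos) {F N : Finset V} {idx : V → ℕ}
    (hA : IsClass G F N A)
    (hinj : ∀ u ∈ A, pos u = 0 → ∀ v ∈ A, pos v = 0 → idx u = idx v → u = v)
    (hnonhead : ∀ u ∈ A, pos u ≠ 0 → idx u = 0)
    (hpos : ∀ u ∈ A, ∀ v ∈ A, pos u = 0 → Consecutive comp pos u v → idx u ≠ 0)
    {C : V → V → Fin 3}
    (hcons : ∀ u ∈ A, ∀ v ∈ A, G.Adj u v → (C u v = 2 ↔ Consecutive comp pos u v))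
    (htok : ∀ u ∈ A, ∀ v ∈ A, (∀ x ∈ N, C x u = C x v) →
      outsideTwos G C (F ∪ A) u = outsideTwos G C (F ∪ A) v → idx u = idx v)
    {φ : G ≃g G} (hφ : Preserves C φ) (hF : ∀ x ∈ F, φ x = x) : ∀ u ∈ A, φ u = u := by
  have hFφ : ∀ x, φ x ∈ F ↔ x ∈ F := by
    refine fun x => ⟨fun hx => ?_, fun hx => (hF x hx).symm ▸ hx⟩
    have := φ.injective (hF _ hx)
    rwa [this] at hx
  have hAφ : ∀ u, φ u ∈ A ↔ u ∈ A := by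
    intro u
    have : F.filter (G.Adj (φ u)) = F.filter (G.Adj u) := by
      refine Finset.filter_congr fun x hx => ?_
      rw [← φ.map_adj_iff (v := u), hF x hx]
    rw [hA, hA, hFφ, this]
  have hNF : ∀ u ∈ A, ∀ x ∈ N, x ∈ F ∧ G.Adj u x := by
    intro u hu x hx
    rw [← ((hA u).1 hu).2] at hx
    simpa using hx
  have hout : ∀ u, outsideTwos G C (F ∪ A) (φ u) = outsideTwos G C (F ∪ A) u := by
    intro u
    refine (Finset.card_bij (fun y _ => φ y) ?_ (fun _ _ _ _ h => φ.injective h) ?_).symm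
    · intro y hy
      simp only [Finset.mem_filter, Finset.mem_sdiff, mem_neighborFinset, Finset.mem_union, hFφ,
        hAφ, φ.map_adj_iff] at hy ⊢
      rw [hφ u y hy.1.1]
      exact hy
    · intro y hy
      obtain ⟨z, rfl⟩ := φ.surjective y
      simp only [Finset.mem_filter, Finset.mem_sdiff, mem_neighborFinset, Finset.mem_union, hFφ,
        hAφ, φ.map_adj_iff] at hy
      refine ⟨z, ?_, rfl⟩
      simp only [Finset.mem_filter, Finset.mem_sdiff, mem_neighborFinset, Finset.mem_union]
      rw [hφ u z hy.1.1] at hy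
      exact hy
  have hidx : ∀ u ∈ A, idx (φ u) = idx u := by
    refine fun u hu => htok _ ((hAφ u).2 hu) u hu (fun x hx => ?_) (hout u)
    obtain ⟨hxF, hux⟩ := hNF u hu x hx
    rw [← hφ x u hux.symm, hF x hxF]
  have hconsφ : ∀ u ∈ A, ∀ v ∈ A, Consecutive comp pos (φ u) (φ v) ↔ Consecutive comp pos u v := by
    intro u hu v hv
    constructor
    · intro huv
      have hadj := h.adj ((hAφ u).2 hu) ((hAφ v).2 hv) huv
      rw [← hcons _ ((hAφ u).2 hu) _ ((hAφ v).2 hv) hadj] at huv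
      rw [φ.map_adj_iff] at hadj
      rwa [← hcons u hu v hv hadj, ← hφ u v hadj]
    · intro huv
      have hadj := h.adj hu hv huv
      rw [← hcons u hu v hv hadj, ← hφ u v hadj] at huv
      rwa [← hcons _ ((hAφ u).2 hu) _ ((hAφ v).2 hv) (φ.map_adj_iff.2 hadj)]
  refine h.eq_of_heads φ.injective (fun u hu => (hAφ u).2 hu)
    (fun u hu v hv huv => (hconsφ u hu v hv).2 huv) fun u hu hu0 => ?_
  have hu' := (hAφ u).2 hu
  by_cases hv0 : pos (φ u) = 0
  · exact hinj _ hu' hv0 u hu hu0 (hidx u hu)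
  · obtain ⟨p, hp, hpc, hpp, -⟩ := h.pred _ hu' hv0
    obtain ⟨w, rfl⟩ := φ.surjective p
    have hw := (hAφ w).1 hp
    have huw := (hconsφ u hu w hw).1 ⟨hpc.symm, Or.inr hpp⟩
    have := hnonhead _ hu' hv0
    rw [hidx u hu] at this
    exact absurd this (hpos u hu w hw hu0 huw)

/-- The colouring `C` agrees with `c` on `F`, and every `x ∈ F` sends `t x` edges of colour `2` to
vertices outside `F`. -/
structure Completes (G : SimpleGraph V) [G.LocallyFinite] (F : Finset V) (c : V → V → Fin 3)
    (t : V → ℕ) (C : V → V → Fin 3) : Prop where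
  agree : ∀ x ∈ F, ∀ y ∈ F, G.Adj x y → C x y = c x y
  twos : ∀ x ∈ F, outsideTwos G C F x = t x

/-- A partial colouring `c` of the edges inside `F`, with promised numbers `t` of outgoing edges of
colour `2`, each of whose completions can only be preserved by automorphisms fixing `F` pointwise
if the root `r` is fixed. The condition `light` keeps all other vertices distinguishable from the
root. -/
structure IsState (G : SimpleGraph V) [G.LocallyFinite] (Δ : ℕ) (r e : V) (F : Finset V)
    (c : V → V → Fin 3) (t : V → ℕ) : Prop where
  symm : ∀ x y, c x y = c y x
  promise : ∀ x ∈ F, 2 * t x ≤ outside G F x + 1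
  inner : ∀ x ∈ F, ∃ y ∈ F, G.Adj x y
  light : ∀ x ∈ F, x ≠ r → (t x ≠ 0 ∨ ∃ y ∈ F, G.Adj x y ∧ c x y = 2) ∨
    2 * insideOnes G c F x + outside G F x ≤ Δ ∨
    (x = e ∧ outside G F x ≠ 0 ∧ 2 * insideOnes G c F x + outside G F x ≤ Δ + 1)
  root_mem : r ∈ F
  root_adj : ∀ y, G.Adj r y → y ∈ F ∧ c r y ≠ 2
  root_heavy : Δ + 1 ≤ 2 * insideOnes G c F r
  rigid : ∀ C, Completes G F c t C → ∀ φ : G ≃g G, Preserves C φ → φ r = r → ∀ x ∈ F, φ x = x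

theorem Extends.completes {F F' : Finset V} {c c' : V → V → Fin 3} {t t' : V → ℕ}
    (h : Extends G F c t F' c' t') {C : V → V → Fin 3} (hC : Completes G F' c' t' C) :
    Completes G F c t C where
  agree := fun x hx y hy hxy => by
    rw [hC.agree x (h.subset hx) y (h.subset hy) hxy, h.agree x hx y hy]
  twos := by
    intro x hx
    have hsplit : (G.neighborFinset x \ F).filter (fun y => C x y = 2) =
        (G.neighborFinset x \ F').filter (fun y => C x y = 2) ∪
          (F' \ F).filter (fun y => G.Adj x y ∧ c' x y = 2) := by
      ext y
      simp only [Finset.mem_filter, Finset.mem_sdiff, Finset.mem_union, mem_neighborFinset]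
      by_cases hy : y ∈ F'
      · have := hC.agree x (h.subset hx) y hy
        simp only [hy, true_and, not_true_eq_false, and_false, false_and, false_or]
        constructor
        · rintro ⟨⟨h1, h2⟩, h3⟩
          exact ⟨h2, h1, (this h1) ▸ h3⟩
        · rintro ⟨h2, h1, h3⟩
          exact ⟨⟨h1, h2⟩, (this h1).trans h3⟩
      · have : y ∉ F := fun hyF => hy (h.subset hyF)
        simp [hy, this]
    rw [outsideTwos, hsplit, Finset.card_union_of_disjoint, h.twos x hx,
      ← hC.twos x (h.subset hx), outsideTwos]
    rw [Finset.disjoint_left]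
    intro y hy hy'
    simp only [Finset.mem_filter, Finset.mem_sdiff] at hy hy'
    exact hy.1.2 hy'.1.1

theorem IsClass.outside_of_mem {F N : Finset V} (hA : IsClass G F N A) {x : V} (hxF : x ∈ F)
    (hx : x ∈ N) : outside G (F ∪ A) x + A.card = outside G F x := by
  have : A ⊆ G.neighborFinset x \ F := by
    intro u hu
    simp only [Finset.mem_sdiff, mem_neighborFinset]
    exact ⟨((hA.adj_iff hu hxF).2 hx).symm, ((hA u).1 hu).1⟩
  rw [outside, outside, ← Finset.card_sdiff_add_card_eq_card this]
  congr 2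
  ext y
  simp only [Finset.mem_sdiff, Finset.mem_union]
  tauto

theorem IsClass.outside_of_notMem {F N : Finset V} (hA : IsClass G F N A) {x : V} (hxF : x ∈ F)
    (hx : x ∉ N) : outside G (F ∪ A) x = outside G F x := by
  unfold outside
  congr 1
  ext y
  simp only [Finset.mem_sdiff, Finset.mem_union, mem_neighborFinset]
  have : G.Adj x y → y ∉ A := fun hxy hy => hx ((hA.adj_iff hy hxF).1 hxy.symm)
  tauto

theorem IsClass.outside_add {F N : Finset V} (hA : IsClass G F N A) {u : V} (hu : u ∈ A) :
    outside G (F ∪ A) u + N.card + (A.filter (G.Adj u)).card = G.degree u := by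
  rw [← ((hA u).1 hu).2, add_assoc, ← Finset.card_union_of_disjoint
    (Finset.disjoint_filter_filter hA.disjoint), ← Finset.filter_union, outside, degree,
    ← Finset.card_sdiff_add_card_inter (G.neighborFinset u) (F ∪ A)]
  congr 2
  ext y
  simp [and_comm]

/-- A state can be extended to any vertex adjacent to it. -/
theorem IsState.exists_step {Δ : ℕ} (hreg : G.IsRegularOfDegree Δ) {r e : V} {F : Finset V}
    {c : V → V → Fin 3} {t : V → ℕ} (hs : IsState G Δ r e F c t) {v x₀ : V} (hv : v ∉ F)
    (hx₀ : x₀ ∈ F) (hvx₀ : G.Adj v x₀) :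
    ∃ F' c' t', IsState G Δ r e F' c' t' ∧ Extends G F c t F' c' t' ∧ v ∈ F' := by
  obtain ⟨N, hN⟩ : ∃ N, N = F.filter (G.Adj v) := ⟨_, rfl⟩
  have hx₀N : x₀ ∈ N := by simp [hN, hx₀, hvx₀]
  obtain ⟨A, hA⟩ : ∃ A, IsClass G F N A := by
    refine ⟨(G.neighborFinset x₀).filter (fun u => u ∉ F ∧ F.filter (G.Adj u) = N), fun u => ?_⟩
    simp only [Finset.mem_filter, mem_neighborFinset, and_iff_right_iff_imp]
    rintro ⟨-, huN⟩
    rw [← huN] at hx₀N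
    exact (Finset.mem_filter.1 hx₀N).2.symm
  have hvA : v ∈ A := (hA v).2 ⟨hv, hN.symm⟩
  have hNF : N ⊆ F := hA.subset hvA
  have hdisj := Finset.disjoint_left.1 hA.disjoint
  have hdisj' := Finset.disjoint_right.1 hA.disjoint
  have haΔ : A.card + 1 ≤ Δ := by
    obtain ⟨y, hy, hxy⟩ := hs.inner x₀ hx₀
    rw [← hreg.degree_eq x₀, degree, ← Finset.card_insert_of_notMem (hdisj hy)]
    refine Finset.card_le_card fun u hu => ?_
    rw [mem_neighborFinset]
    rcases Finset.mem_insert.1 hu with rfl | hu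
    · exact hxy
    · exact ((hA.adj_iff hu hx₀).2 hx₀N).symm
  obtain ⟨comp, pos, hpath, hdeg⟩ := exists_isPathSystem G A
  obtain ⟨idx, K, hinj, hnonhead, hidx, hK, hKk⟩ := hpath.exists_index
  obtain ⟨k, hk⟩ : ∃ k, k = (A.filter (fun u => pos u = 0)).card := ⟨_, rfl⟩
  rw [← hk] at hKk hdeg
  have hk1 : 1 ≤ k := by
    obtain ⟨u, hu, hu0⟩ := hpath.exists_head ⟨v, hvA⟩
    rw [hk]
    exact Finset.card_pos.2 ⟨u, by simp [hu, hu0]⟩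
  have hka : k ≤ A.card := hk ▸ Finset.card_filter_le _ _
  obtain ⟨σ, θ, hσ0, hθ0, hσθ, hσN, hθ, hσ1, hmark, hmarke⟩ :=
    exists_tokens N ⟨x₀, hx₀N⟩ e hk1 (K := K) (by omega) (by omega) hka
  have hP : ∀ x, (A.filter (fun u => σ (idx u) = some x)).card ≤
      ((Finset.range K).filter (fun i => σ i = some x)).card := by
    intro x
    have hhead : ∀ u ∈ A, σ (idx u) = some x → pos u = 0 := by
      intro u hu hux
      by_contra h0
      simp [hnonhead u hu h0, hσ0] at hux
    refine Finset.card_le_card_of_injOn idx (fun u hu => ?_) (fun u hu w hw huw => ?_)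
    · simp only [Finset.coe_filter, Set.mem_ofPred_eq, Finset.mem_range] at hu ⊢
      exact ⟨hK u hu.1, hu.2⟩
    · simp only [Finset.coe_filter, Set.mem_ofPred_eq] at hu hw
      exact hinj u hu.1 (hhead u hu.1 hu.2) w hw.1 (hhead w hw.1 hw.2) huw
  have hJ : ∀ x, ∃ J ⊆ A.filter (fun u => σ (idx u) ≠ some x),
      J.card = min (t x) ((A.card + 1) / 2) := by
    intro x
    refine Finset.exists_subset_card_eq ?_
    have := Finset.card_filter_add_card_filter_not (s := A) (fun u => σ (idx u) = some x)
    have := hP x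
    have := hmark x
    simp only [ne_eq]
    omega
  choose J hJA hJcard using hJ
  obtain ⟨c', hc'⟩ : ∃ c', c' = extendColour A comp pos (fun u => σ (idx u)) J c := ⟨_, rfl⟩
  obtain ⟨t', ht'⟩ : ∃ t' : V → ℕ, t' = fun x =>
    if x ∈ A then θ (idx x) else if x ∈ N then t x - (J x).card else t x := ⟨_, rfl⟩
  have ht'A : ∀ u ∈ A, t' u = θ (idx u) := fun u hu => by simp [ht', hu]
  have ht'N : ∀ x ∈ N, t' x = t x - (J x).card := fun x hx => by
    simp [ht', hx, hdisj (hNF hx)]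
  have ht'F : ∀ x ∈ F, x ∉ N → t' x = t x := fun x hxF hx => by
    simp [ht', hx, hdisj hxF]
  have hold : ∀ x ∈ F, ∀ y ∈ F, c' x y = c x y := fun x hx y hy => by
    rw [hc', extendColour_old (hdisj hx) (hdisj hy)]
  have hJtwo : ∀ x ∈ F, ∀ u ∈ A, c' x u = 2 ↔ u ∈ J x := by
    intro x hx u hu
    rw [hc', extendColour_cross_eq_two (hdisj hx) hu]
    exact ⟨And.right, fun h => ⟨(Finset.mem_filter.1 (hJA x h)).2, h⟩⟩
  have hones : ∀ x ∈ F, insideOnes G c' (F ∪ A) x =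
      insideOnes G c F x + (A.filter (fun u => σ (idx u) = some x)).card := fun x hx => by
    rw [hc', hA.insideOnes_old hx fun u hu y h => hσN _ (hK u hu) y h]
  have hPF : ∀ x, x ∉ N → (A.filter (fun u => σ (idx u) = some x)).card = 0 := by
    intro x hx
    rw [Finset.card_eq_zero, Finset.filter_eq_empty_iff]
    exact fun u hu h => hx (hσN _ (hK u hu) x h)
  have hrN : r ∉ N := fun hr =>
    hv (hs.root_adj v ((hA.adj_iff hvA hs.root_mem).2 hr).symm).1
  have hext : Extends G F c t (F ∪ A) c' t' := by
    refine ⟨Finset.subset_union_left, hold, fun x hx => ?_⟩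
    rw [Finset.union_sdiff_cancel_left hA.disjoint]
    by_cases hxN : x ∈ N
    · have : A.filter (fun y => G.Adj x y ∧ c' x y = 2) = J x := by
        ext u
        simp only [Finset.mem_filter]
        constructor
        · rintro ⟨hu, -, h2⟩
          exact (hJtwo x hx u hu).1 h2
        · intro hu
          have huA := Finset.filter_subset _ _ (hJA x hu)
          exact ⟨huA, ((hA.adj_iff huA hx).2 hxN).symm, (hJtwo x hx u huA).2 hu⟩
      rw [this, ht'N x hxN]
      have := hJcard x
      omega
    · rw [ht'F x hx hxN, Finset.filter_eq_empty_iff.2, Finset.card_empty, add_zero]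
      exact fun u hu h => hxN ((hA.adj_iff hu hx).1 h.1.symm)
  refine ⟨F ∪ A, c', t', ?_, hext, Finset.mem_union_right _ hvA⟩
  have hsymm : ∀ x y, c' x y = c' y x := fun x y => by rw [hc', extendColour_symm hs.symm]
  refine ⟨hsymm, ?_, ?_, ?_, Finset.mem_union_left _ hs.root_mem, ?_, ?_, ?_⟩
  · intro x hx
    by_cases hxA : x ∈ A
    · rw [ht'A x hxA]
      by_cases h0 : pos x = 0
      · have h1 := hA.outside_add hxA
        rw [hreg.degree_eq x] at h1
        have h2 := hdeg x hxA h0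
        have h3 := hθ _ (hK x hxA)
        omega
      · simp [hnonhead x hxA h0, hθ0]
    · have hxF : x ∈ F := (Finset.mem_union.1 hx).resolve_right hxA
      have h1 := hs.promise x hxF
      by_cases hxN : x ∈ N
      · have h2 := hA.outside_of_mem hxF hxN
        have h3 := hJcard x
        rw [ht'N x hxN]
        omega
      · rwa [ht'F x hxF hxN, hA.outside_of_notMem hxF hxN]
  · intro x hx
    rcases Finset.mem_union.1 hx with hxF | hxA
    · obtain ⟨y, hy, hxy⟩ := hs.inner x hxF
      exact ⟨y, Finset.mem_union_left _ hy, hxy⟩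
    · exact ⟨x₀, Finset.mem_union_left _ hx₀, (hA.adj_iff hxA hx₀).2 hx₀N⟩
  · intro x hx hxr
    by_cases hxA : x ∈ A
    · by_cases h0 : pos x = 0
      · have h1 := hA.outside_add hxA
        rw [hreg.degree_eq x] at h1
        have h2 : insideOnes G c' (F ∪ A) x ≤ (σ (idx x)).toFinset.card := by
          rw [hc']
          exact insideOnes_extendColour_le hs.symm hxA
        rcases hσx : σ (idx x) with _ | y
        · rw [hσx] at h2
          simp only [Option.toFinset_none, Finset.card_empty] at h2
          exact Or.inr (Or.inl (by omega))
        · rw [hσx] at h2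
          simp only [Option.toFinset_some, Finset.card_singleton] at h2
          by_cases hn : N.card = 1
          · exact Or.inl (Or.inl (ht'A x hxA ▸ hσ1 hn _ (hK x hxA) (by simp [hσx])))
          · have := Finset.card_pos.2 ⟨x₀, hx₀N⟩
            exact Or.inr (Or.inl (by omega))
      · obtain ⟨p, hp, hpc, hpp, hadj⟩ := hpath.pred x hxA h0
        refine Or.inl (Or.inr ⟨p, Finset.mem_union_right _ hp, hadj.symm, ?_⟩)
        rw [hc', extendColour_inner_eq_two hxA hp]
        exact ⟨hpc.symm, Or.inr hpp⟩
    · have hxF : x ∈ F := (Finset.mem_union.1 hx).resolve_right hxA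
      have htwo : (∃ y ∈ F, G.Adj x y ∧ c x y = 2) → ∃ y ∈ F ∪ A, G.Adj x y ∧ c' x y = 2 := by
        rintro ⟨y, hy, hxy, h2⟩
        exact ⟨y, Finset.mem_union_left _ hy, hxy, (hold x hxF y hy).trans h2⟩
      by_cases hxN : x ∈ N
      · have h1 := hA.outside_of_mem hxF hxN
        have h2 := hones x hxF
        have h3 := hP x
        have h4 := hmark x
        rcases hs.light x hxF hxr with (h | h) | h | ⟨rfl, h, h'⟩
        · by_cases hJ0 : (J x).Nonempty
          · obtain ⟨u, hu⟩ := hJ0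
            have huA := Finset.filter_subset _ _ (hJA x hu)
            exact Or.inl (Or.inr ⟨u, Finset.mem_union_right _ huA,
              ((hA.adj_iff huA hxF).2 hxN).symm, (hJtwo x hxF u huA).2 hu⟩)
          · rw [Finset.not_nonempty_iff_eq_empty] at hJ0
            refine Or.inl (Or.inl ?_)
            rwa [ht'N x hxN, hJ0, Finset.card_empty, Nat.sub_zero]
        · exact Or.inl (Or.inr (htwo h))
        · exact Or.inr (Or.inl (by omega))
        · exact Or.inr (Or.inl (by omega))
      · have h1 := hones x hxF
        rw [hPF x hxN, add_zero] at h1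
        rw [h1, hA.outside_of_notMem hxF hxN, ht'F x hxF hxN]
        exact (hs.light x hxF hxr).imp_left (Or.imp_right htwo)
  · intro y hy
    obtain ⟨hyF, h2⟩ := hs.root_adj y hy
    exact ⟨Finset.mem_union_left _ hyF, by rwa [hold r hs.root_mem y hyF]⟩
  · rw [hones r hs.root_mem, hPF r hrN]
    exact hs.root_heavy
  · intro C hC φ hφ hr
    have hfix := hs.rigid C (hext.completes hC) φ hφ hr
    have hAF : ∀ u ∈ A, u ∈ F ∪ A := fun u hu => Finset.mem_union_right _ hu
    have hcross : ∀ x ∈ N, ∀ u ∈ A, C x u = 1 ↔ σ (idx u) = some x := by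
      intro x hx u hu
      rw [hC.agree x (Finset.mem_union_left _ (hNF hx)) u (hAF u hu)
        ((hA.adj_iff hu (hNF hx)).2 hx).symm, hc', extendColour_cross_eq_one (hdisj (hNF hx)) hu]
    have hfixA : ∀ u ∈ A, φ u = u := by
      refine hpath.fixes hA hinj hnonhead hidx (C := C) ?_ ?_ hφ hfix
      · intro u hu w hw huw
        rw [hC.agree u (hAF u hu) w (hAF w hw) huw, hc', extendColour_inner_eq_two hu hw]
      · intro u hu w hw hcol hout
        rw [hC.twos u (hAF u hu), hC.twos w (hAF w hw), ht'A u hu, ht'A w hw] at hout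
        refine hσθ _ (hK u hu) _ (hK w hw) (Option.ext fun x => ?_) hout
        constructor
        · intro h
          have hx := hσN _ (hK u hu) x h
          rw [← hcross x hx w hw, ← hcol x hx, hcross x hx u hu]
          exact h
        · intro h
          have hx := hσN _ (hK w hw) x h
          rw [← hcross x hx u hu, hcol x hx, hcross x hx w hw]
          exact h
    exact fun x hx => (Finset.mem_union.1 hx).elim (hfix x) (hfixA x)

/-- There is a state consisting of a vertex `r` and its neighbours. -/
theorem exists_isState {Δ : ℕ} (hΔ : 2 ≤ Δ) (hreg : G.IsRegularOfDegree Δ) (r : V)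
    (hr : 3 ≤ Δ ∨ ∀ u v, G.Adj r u → G.Adj r v → ¬ G.Adj u v) :
    ∃ e F c t, IsState G Δ r e F c t := by
  obtain ⟨A, hAr⟩ : ∃ A, A = G.neighborFinset r := ⟨_, rfl⟩
  have hmem : ∀ u, u ∈ A ↔ G.Adj r u := fun u => by rw [hAr, mem_neighborFinset]
  have hA : IsClass G {r} {r} A := by
    intro u
    rw [hmem, Finset.filter_eq_self]
    simp only [Finset.mem_singleton, forall_eq]
    exact ⟨fun h => ⟨h.ne', h.symm⟩, fun h => h.2.symm⟩
  have haΔ : A.card = Δ := by rw [hAr, card_neighborFinset_eq_degree, hreg.degree_eq]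
  have hrA : r ∉ A := fun h => G.loopless.irrefl r ((hmem r).1 h)
  obtain ⟨comp, pos, hpath, hdeg⟩ := exists_isPathSystem G A
  obtain ⟨idx, K, hinj, hnonhead, hidx, hK, hKk⟩ := hpath.exists_index
  obtain ⟨k, hk⟩ : ∃ k, k = (A.filter (fun u => pos u = 0)).card := ⟨_, rfl⟩
  rw [← hk] at hKk hdeg
  obtain ⟨u₀, hu₀, hu₀0⟩ := hpath.exists_head (Finset.card_pos.1 (by omega))
  have hk1 : 1 ≤ k := by
    rw [hk]
    exact Finset.card_pos.2 ⟨u₀, by simp [hu₀, hu₀0]⟩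
  have hka : k ≤ A.card := hk ▸ Finset.card_filter_le _ _
  obtain ⟨D, hD⟩ : ∃ D, D = k / 2 + 1 := ⟨_, rfl⟩
  have hKD : 2 * (K - D) + 1 ≤ Δ := by
    rcases hKk with hKk | ⟨hKk, h2k, hnbr⟩
    · omega
    · rcases hr with hr | hr
      · omega
      · obtain ⟨w, hw, huw⟩ := hnbr u₀ hu₀ hu₀0
        exact absurd huw (hr u₀ w ((hmem u₀).1 hu₀) ((hmem w).1 hw))
  have hKk' : K ≤ k + 1 := by omega
  obtain ⟨e, he⟩ : ∃ e, ∀ u ∈ A, pos u = 0 → idx u = 0 → u = e := by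
    by_cases h : ∃ e ∈ A, pos e = 0 ∧ idx e = 0
    · obtain ⟨e, heA, he0, hei⟩ := h
      exact ⟨e, fun u hu hu0 hui => hinj u hu hu0 e heA he0 (hui.trans hei.symm)⟩
    · push Not at h
      exact ⟨r, fun u hu hu0 hui => absurd hui (h u hu hu0)⟩
  obtain ⟨S, hS⟩ : ∃ S : V → Option V, S = fun u => if idx u < D then some r else none := ⟨_, rfl⟩
  have hSr : ∀ u, S u = some r ↔ idx u < D := fun u => by simp [hS]
  obtain ⟨c, hc⟩ : ∃ c, c = extendColour A comp pos S (fun _ => ∅) (fun _ _ => 0) := ⟨_, rfl⟩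
  obtain ⟨t, ht⟩ : ∃ t : V → ℕ, t = fun u =>
    if u ∈ A then if idx u < D then idx u else idx u - D else 0 := ⟨_, rfl⟩
  have htA : ∀ u ∈ A, t u = if idx u < D then idx u else idx u - D := fun u hu => by simp [ht, hu]
  have hout : ∀ u ∈ A, outside G ({r} ∪ A) u + 1 + (A.filter (G.Adj u)).card = Δ := by
    intro u hu
    have := hA.outside_add hu
    rwa [hreg.degree_eq u, Finset.card_singleton] at this
  have hrF : r ∈ ({r} ∪ A : Finset V) := by simp
  have hAF : ∀ u ∈ A, u ∈ {r} ∪ A := fun u hu => Finset.mem_union_right _ hu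
  refine ⟨e, {r} ∪ A, c, t, ?_, ?_, ?_, ?_, hrF, ?_, ?_, ?_⟩
  · intro x y
    rw [hc, extendColour_symm fun _ _ => rfl]
  · intro x hx
    by_cases hxA : x ∈ A
    · have h1 := hout x hxA
      have h2 := hK x hxA
      rw [htA x hxA]
      by_cases h0 : pos x = 0
      · have h3 := hdeg x hxA h0
        split_ifs <;> omega
      · simp [hnonhead x hxA h0]
    · simp [ht, hxA]
  · intro x hx
    rcases Finset.mem_union.1 hx with hxr | hxA
    · rw [Finset.mem_singleton.1 hxr]
      exact ⟨u₀, hAF u₀ hu₀, (hmem u₀).1 hu₀⟩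
    · exact ⟨r, hrF, ((hmem x).1 hxA).symm⟩
  · intro x hx hxr
    have hxA : x ∈ A := by simpa [hxr] using hx
    by_cases h0 : pos x = 0
    · have h1 := hout x hxA
      have h2 : insideOnes G c ({r} ∪ A) x ≤ (S x).toFinset.card := by
        rw [hc]
        exact insideOnes_extendColour_le (fun _ _ => rfl) hxA
      by_cases hi : idx x < D
      · rw [(hSr x).2 hi] at h2
        simp only [Option.toFinset_some, Finset.card_singleton] at h2
        by_cases hi0 : idx x = 0
        · by_cases ho : outside G ({r} ∪ A) x = 0
          · exact Or.inr (Or.inl (by omega))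
          · exact Or.inr (Or.inr ⟨he x hxA h0 hi0, ho, by omega⟩)
        · refine Or.inl (Or.inl ?_)
          rwa [htA x hxA, if_pos hi]
      · have : S x = none := by simp [hS, hi]
        rw [this] at h2
        simp only [Option.toFinset_none, Finset.card_empty] at h2
        exact Or.inr (Or.inl (by omega))
    · obtain ⟨p, hp, hpc, hpp, hadj⟩ := hpath.pred x hxA h0
      refine Or.inl (Or.inr ⟨p, hAF p hp, hadj.symm, ?_⟩)
      rw [hc, extendColour_inner_eq_two hxA hp]
      exact ⟨hpc.symm, Or.inr hpp⟩
  · intro y hy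
    have hyA := (hmem y).2 hy
    refine ⟨hAF y hyA, ?_⟩
    rw [hc, ne_eq, extendColour_cross_eq_two hrA hyA]
    simp
  · have h1 : insideOnes G c ({r} ∪ A) r = insideOnes G (fun _ _ => 0) {r} r +
        (A.filter (fun u => S u = some r)).card := by
      rw [hc]
      refine hA.insideOnes_old (Finset.mem_singleton_self r) fun u _ y h => ?_
      simp only [hS] at h
      split_ifs at h
      simpa [eq_comm] using h
    have h2 := Finset.card_filter_add_card_filter_not (s := A) (fun u => S u = some r)
    have h3 : (A.filter (fun u => ¬ S u = some r)).card ≤ K - D := by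
      rw [← Nat.card_Ico]
      have hhead : ∀ u ∈ A, ¬ S u = some r → pos u = 0 := by
        intro u hu hSu
        rw [hSr] at hSu
        by_contra h0
        have := hnonhead u hu h0
        omega
      refine Finset.card_le_card_of_injOn idx (fun u hu => ?_) (fun u hu w hw huw => ?_)
      · simp only [Finset.coe_filter, Set.mem_ofPred_eq, hSr, Finset.coe_Ico, Set.mem_Ico] at hu ⊢
        exact ⟨by omega, hK u hu.1⟩
      · simp only [Finset.coe_filter, Set.mem_ofPred_eq] at hu hw
        exact hinj u hu.1 (hhead u hu.1 hu.2) w hw.1 (hhead w hw.1 hw.2) huw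
    omega
  · intro C hC φ hφ hφr
    have hfix : ∀ x ∈ ({r} : Finset V), φ x = x := by simpa using hφr
    have hcross : ∀ u ∈ A, C r u = 1 ↔ idx u < D := by
      intro u hu
      rw [hC.agree r hrF u (hAF u hu) ((hmem u).1 hu), hc, extendColour_cross_eq_one hrA hu, hSr]
    have hfixA : ∀ u ∈ A, φ u = u := by
      refine hpath.fixes hA hinj hnonhead hidx (C := C) ?_ ?_ hφ hfix
      · intro u hu w hw huw
        rw [hC.agree u (hAF u hu) w (hAF w hw) huw, hc, extendColour_inner_eq_two hu hw]
      · intro u hu w hw hcol hout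
        rw [hC.twos u (hAF u hu), hC.twos w (hAF w hw), htA u hu, htA w hw] at hout
        have h1 := hcross u hu
        rw [hcol r (Finset.mem_singleton_self r), hcross w hw] at h1
        split_ifs at hout <;> omega
    exact fun x hx => (Finset.mem_union.1 hx).elim (hfix x) (hfixA x)

theorem IsState.exists_extends_of_adj {Δ : ℕ} (hreg : G.IsRegularOfDegree Δ) {r e : V}
    {F : Finset V} {c : V → V → Fin 3} {t : V → ℕ} (hs : IsState G Δ r e F c t) (T : Finset V)
    (hT : ∀ v ∈ T, ∃ x ∈ F, G.Adj v x) :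
    ∃ F' c' t', IsState G Δ r e F' c' t' ∧ Extends G F c t F' c' t' ∧ T ⊆ F' := by
  induction T using Finset.induction_on with
  | empty => exact ⟨F, c, t, hs, .refl F c t, Finset.empty_subset F⟩
  | insert v T _ ih =>
    obtain ⟨F', c', t', hs', hext, hTF⟩ := ih fun w hw => hT w (Finset.mem_insert_of_mem hw)
    by_cases hv : v ∈ F'
    · exact ⟨F', c', t', hs', hext, Finset.insert_subset hv hTF⟩
    · obtain ⟨x, hx, hvx⟩ := hT v (Finset.mem_insert_self v T)
      obtain ⟨F'', c'', t'', hs'', hext', hv'⟩ := hs'.exists_step hreg hv (hext.subset hx) hvx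
      exact ⟨F'', c'', t'', hs'', hext.trans hext',
        Finset.insert_subset hv' (hTF.trans hext'.subset)⟩

/-- A state can be extended to all neighbours of its vertices. -/
theorem IsState.exists_extends {Δ : ℕ} (hreg : G.IsRegularOfDegree Δ) {r e : V}
    {F : Finset V} {c : V → V → Fin 3} {t : V → ℕ} (hs : IsState G Δ r e F c t) :
    ∃ F' c' t', IsState G Δ r e F' c' t' ∧ Extends G F c t F' c' t' ∧
      ∀ x ∈ F, ∀ y, G.Adj x y → y ∈ F' := by
  obtain ⟨F', c', t', hs', hext, hT⟩ := hs.exists_extends_of_adj hreg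
    (F.biUnion fun x => G.neighborFinset x) fun v hv => by
      obtain ⟨x, hx, hxv⟩ := Finset.mem_biUnion.1 hv
      exact ⟨x, hx, ((mem_neighborFinset _ _ _).1 hxv).symm⟩
  exact ⟨F', c', t', hs', hext, fun x hx y hxy =>
    hT (Finset.mem_biUnion.2 ⟨x, hx, (mem_neighborFinset _ _ _).2 hxy⟩)⟩

/-- The limit of a sequence of states growing from a given one is a distinguishing colouring. -/
theorem IsState.exists_colouring {Δ : ℕ} (hreg : G.IsRegularOfDegree Δ) (hconn : G.Connected)
    {r e : V} {F₀ : Finset V} {c₀ : V → V → Fin 3} {t₀ : V → ℕ}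
    (hs₀ : IsState G Δ r e F₀ c₀ t₀) :
    ∃ C : V → V → Fin 3, (∀ x y, C x y = C y x) ∧
      ∀ φ : G ≃g G, Preserves C φ → ∀ v, φ v = v := by
  let State := {s : Finset V × (V → V → Fin 3) × (V → ℕ) // IsState G Δ r e s.1 s.2.1 s.2.2}
  have hnext : ∀ s : State, ∃ s' : State,
      Extends G s.1.1 s.1.2.1 s.1.2.2 s'.1.1 s'.1.2.1 s'.1.2.2 ∧
      ∀ x ∈ s.1.1, ∀ y, G.Adj x y → y ∈ s'.1.1 := by
    intro s
    obtain ⟨F, c, t, hs, h⟩ := s.2.exists_extends hreg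
    exact ⟨⟨(F, c, t), hs⟩, h⟩
  choose next hext hnbr using hnext
  let seq : ℕ → State := Nat.rec ⟨(F₀, c₀, t₀), hs₀⟩ fun _ s => next s
  obtain ⟨F, hF⟩ : ∃ F : ℕ → Finset V, F = fun n => (seq n).1.1 := ⟨_, rfl⟩
  obtain ⟨c, hc⟩ : ∃ c : ℕ → V → V → Fin 3, c = fun n => (seq n).1.2.1 := ⟨_, rfl⟩
  obtain ⟨t, ht⟩ : ∃ t : ℕ → V → ℕ, t = fun n => (seq n).1.2.2 := ⟨_, rfl⟩
  have hs : ∀ n, IsState G Δ r e (F n) (c n) (t n) := fun n => by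
    subst hF hc ht
    exact (seq n).2
  have hstep : ∀ n, Extends G (F n) (c n) (t n) (F (n + 1)) (c (n + 1)) (t (n + 1)) := fun n => by
    subst hF hc ht
    exact hext (seq n)
  have hball : ∀ n, ∀ x ∈ F n, ∀ y, G.Adj x y → y ∈ F (n + 1) := fun n => by
    subst hF
    exact hnbr (seq n)
  clear_value seq
  clear hF hc ht
  have hmono : ∀ m n, m ≤ n → Extends G (F m) (c m) (t m) (F n) (c n) (t n) := by
    intro m n hmn
    induction n, hmn using Nat.le_induction with
    | base => exact .refl _ _ _
    | succ n _ ih => exact ih.trans (hstep n)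
  have hcover : ∀ x, ∃ n, x ∈ F n := by
    have hwalk : ∀ x y, G.Walk x y → (∃ n, y ∈ F n) → ∃ n, x ∈ F n := by
      intro x y w hy
      induction w with
      | nil => exact hy
      | cons hadj _ ih =>
        obtain ⟨n, hn⟩ := ih hy
        exact ⟨n + 1, hball n _ hn _ hadj.symm⟩
    intro x
    obtain ⟨w⟩ := hconn.preconnected x r
    exact hwalk x r w ⟨0, (hs 0).root_mem⟩
  choose lev hlev using hcover
  obtain ⟨C, hC⟩ : ∃ C : V → V → Fin 3, C = fun x y => c (max (lev x) (lev y)) x y := ⟨_, rfl⟩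
  have hagree : ∀ n, ∀ x ∈ F n, ∀ y ∈ F n, C x y = c n x y := by
    intro n x hx y hy
    have hx' := (hmono _ _ (le_max_left (lev x) (lev y))).subset (hlev x)
    have hy' := (hmono _ _ (le_max_right (lev x) (lev y))).subset (hlev y)
    rw [hC]
    rcases le_total n (max (lev x) (lev y)) with h | h
    · exact (hmono _ _ h).agree x hx y hy
    · exact ((hmono _ _ h).agree x hx' y hy').symm
  have hsub : ∀ n, ∀ x ∈ F n, G.neighborFinset x ⊆ F (n + 1) := fun n x hx y hy =>
    hball n x hx y ((mem_neighborFinset _ _ _).1 hy)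
  have hout : ∀ n, ∀ x ∈ F n, outside G (F (n + 1)) x = 0 := by
    intro n x hx
    rw [outside, Finset.sdiff_eq_empty_iff_subset.2 (hsub n x hx), Finset.card_empty]
  have htzero : ∀ n, ∀ x ∈ F n, t (n + 1) x = 0 := by
    intro n x hx
    have := (hs (n + 1)).promise x ((hstep n).subset hx)
    rw [hout n x hx] at this
    omega
  have hcompl : ∀ n, Completes G (F n) (c n) (t n) C := by
    refine fun n => ⟨fun x hx y hy _ => hagree n x hx y hy, fun x hx => ?_⟩
    rw [(hstep n).twos x hx, htzero n x hx, zero_add, outsideTwos]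
    congr 1
    ext y
    simp only [Finset.mem_filter, Finset.mem_sdiff, mem_neighborFinset]
    constructor
    · rintro ⟨⟨hxy, hy⟩, h2⟩
      have hy' := hball n x hx y hxy
      exact ⟨⟨hy', hy⟩, hxy, by rwa [← hagree (n + 1) x ((hstep n).subset hx) y hy']⟩
    · rintro ⟨⟨hy', hy⟩, hxy, h2⟩
      exact ⟨⟨hxy, hy⟩, by rwa [hagree (n + 1) x ((hstep n).subset hx) y hy']⟩
  refine ⟨C, fun x y => ?_, fun φ hφ v => ?_⟩
  · simp only [hC]
    rw [max_comm, (hs _).symm]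
  · suffices hr : φ r = r from (hs (lev v)).rigid C (hcompl _) φ hφ hr v (hlev v)
    by_contra hr
    obtain ⟨n, hn⟩ : ∃ n, φ r ∈ F n := ⟨_, hlev _⟩
    have hn' := (hstep n).subset hn
    rcases (hs (n + 1)).light _ hn' hr with (h | ⟨z, hz, hadj, h2⟩) | h | ⟨-, h, -⟩
    · exact h (htzero n _ hn)
    · obtain ⟨w, rfl⟩ := φ.surjective z
      rw [φ.map_adj_iff] at hadj
      obtain ⟨hw, hne⟩ := (hs 0).root_adj w hadj
      rw [← hagree (n + 1) _ hn' _ hz, hφ r w hadj, hagree 0 r (hs 0).root_mem w hw] at h2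
      exact hne h2
    · have hle : insideOnes G (c 0) (F 0) r ≤ insideOnes G (c (n + 1)) (F (n + 1)) (φ r) := by
        refine Finset.card_le_card_of_injOn φ (fun w hw => ?_) φ.injective.injOn
        simp only [Finset.coe_filter, Set.mem_ofPred_eq] at hw ⊢
        obtain ⟨hw, hadj, h1⟩ := hw
        have hadj' := φ.map_adj_iff.2 hadj
        have hw' := hball n _ hn _ hadj'
        refine ⟨hw', hadj', ?_⟩
        rw [← hagree (n + 1) _ hn' _ hw', hφ r w hadj, hagree 0 r (hs 0).root_mem w hw, h1]
      have := (hs 0).root_heavy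
      omega
    · exact h (hout n _ hn)

theorem hasDistinguishingEdgeColoring_of_triangle (hconn : G.Connected)
    (hreg : G.IsRegularOfDegree 2) {r u v : V} (hru : G.Adj r u) (hrv : G.Adj r v)
    (huv : G.Adj u v) : HasDistinguishingEdgeColoring G 3 := by
  have hnbr : ∀ x y z, G.Adj x y → G.Adj x z → y ≠ z → ∀ w, G.Adj x w → w = y ∨ w = z := by
    intro x y z hxy hxz hyz w hxw
    have hsub : {y, z} ⊆ G.neighborFinset x := by
      simp [Finset.insert_subset_iff, hxy, hxz]
    have heq := Finset.eq_of_subset_of_card_le hsub (by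
      rw [Finset.card_pair hyz, card_neighborFinset_eq_degree, hreg.degree_eq])
    rw [← mem_neighborFinset, ← heq] at hxw
    simpa using hxw
  have hwalk : ∀ x y, G.Walk x y → (y = r ∨ y = u ∨ y = v) → x = r ∨ x = u ∨ x = v := by
    intro x y w hy
    induction w with
    | nil => exact hy
    | cons hadj _ ih =>
      rcases ih hy with rfl | rfl | rfl
      · exact Or.inr (hnbr _ u v hru hrv huv.ne _ hadj.symm)
      · have := hnbr _ r v hru.symm huv hrv.ne _ hadj.symm
        tauto
      · have := hnbr _ r u hrv.symm huv.symm hru.ne _ hadj.symm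
        tauto
  refine ⟨fun e => if e.1 = s(r, u) then 0 else if e.1 = s(r, v) then 1 else 2, fun φ hφ w => ?_⟩
  have hne : s(r, v) ≠ s(r, u) := by simp [huv.ne', hru.ne]
  have h0 := hφ ⟨s(r, u), hru⟩
  have h1 := hφ ⟨s(r, v), hrv⟩
  have hmap : ∀ x y (h : G.Adj x y), (φ.mapEdgeSet ⟨s(x, y), h⟩).1 = s(φ x, φ y) :=
    fun _ _ _ => rfl
  simp only [hmap] at h0 h1
  have h0' : s(φ r, φ u) = s(r, u) := by
    by_contra hcon
    simp only [hcon, if_true, if_false] at h0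
    split_ifs at h0 <;> simp at h0
  have h1' : s(φ r, φ v) = s(r, v) := by
    by_contra hcon
    simp only [hcon, hne, if_true, if_false] at h1
    split_ifs at h1 <;> simp at h1
  rw [Sym2.eq_iff] at h0' h1'
  have hruv := huv.ne
  have hr' := hru.ne
  have hv' := hrv.ne
  obtain ⟨p⟩ := hconn.preconnected w r
  rcases hwalk w r p (Or.inl rfl) with rfl | rfl | rfl <;> grind

theorem hasDistinguishingEdgeColoring_of_isRegularOfDegree {Δ : ℕ} (hΔ : 2 ≤ Δ)
    (hconn : G.Connected) (hreg : G.IsRegularOfDegree Δ) : HasDistinguishingEdgeColoring G 3 := by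
  obtain ⟨r⟩ := hconn.nonempty
  by_cases hr : 3 ≤ Δ ∨ ∀ u v, G.Adj r u → G.Adj r v → ¬ G.Adj u v
  · obtain ⟨e, F, c, t, hs⟩ := exists_isState hΔ hreg r hr
    obtain ⟨C, hsymm, hC⟩ := hs.exists_colouring hreg hconn
    refine ⟨fun e => Sym2.lift ⟨C, hsymm⟩ e.1, fun φ hφ => hC φ fun x y hxy => ?_⟩
    exact hφ ⟨s(x, y), hxy⟩
  · push Not at hr
    obtain ⟨hΔ3, u, v, hru, hrv, huv⟩ := hr
    obtain rfl : Δ = 2 := by omega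
    exact hasDistinguishingEdgeColoring_of_triangle hconn hreg hru hrv huv

end
end DistinguishingRegular

/-- A connected `Δ`-regular simple graph with `Δ ≥ 2` admits a distinguishing edge colouring
with three colours. -/
theorem stmt_2 {V : Type*} (G : SimpleGraph V) [G.LocallyFinite]
    (Δ : ℕ) (hΔ : 2 ≤ Δ) (hconn : G.Connected) (hreg : G.IsRegularOfDegree Δ) :
    HasDistinguishingEdgeColoring G 3 := by
  exact DistinguishingRegular.hasDistinguishingEdgeColoring_of_isRegularOfDegree hΔ hconn hreg
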